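/- arXiv:1003.4309 — 7 statements merged into one kernel-verified Lean document; each statement's English description precedes it below -/
import Mathlib

section
/- Let d ≥ 1 and let X ⊆ ℝ^d be a repetitive Delone set. Fix S > 0 and x₀ ∈ X, and let R_p ⊆ ℝ^d be the set of occurrences of the S-patch of X centered at x₀. Then R_p is itself a repetitive Delone set: R_p is r′-discrete and R′-dense for some r′, R′ > 0, and for every T > 0 there exists M′ > 0 such that every closed ball of radius M′ in ℝ^d contains an occurrence (in R_p) of every T-patch of R_p centered at a point of R_p. -/
open Metric Set

/-- `X` is `r`-discrete: every closed ball of radius `r` meets `X` in at most one point. -/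
def IsRDiscrete (d : ℕ) (r : ℝ) (X : Set (EuclideanSpace ℝ (Fin d))) : Prop :=
  ∀ z : EuclideanSpace ℝ (Fin d), (X ∩ closedBall z r).Subsingleton

/-- `X` is `R`-dense: every closed ball of radius `R` meets `X` in at least one point. -/
def IsRDense (d : ℕ) (R : ℝ) (X : Set (EuclideanSpace ℝ (Fin d))) : Prop :=
  ∀ z : EuclideanSpace ℝ (Fin d), (X ∩ closedBall z R).Nonempty

/-- `X` is a Delone set. -/
def IsDelone (d : ℕ) (X : Set (EuclideanSpace ℝ (Fin d))) : Prop :=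
  (∃ r > 0, IsRDiscrete d r X) ∧ (∃ R > 0, IsRDense d R X)

/-- `y` is an occurrence of the `S`-patch of `X` centered at `x₀`. -/
def IsOccurrence (d : ℕ) (X : Set (EuclideanSpace ℝ (Fin d))) (S : ℝ)
    (x₀ y : EuclideanSpace ℝ (Fin d)) : Prop :=
  X ∩ closedBall y S = (fun v => v - x₀ + y) '' (X ∩ closedBall x₀ S)

/-- `X` is linearly repetitive with constant `L`. -/
def IsLinearlyRepetitive (d : ℕ) (L : ℝ) (X : Set (EuclideanSpace ℝ (Fin d))) : Prop :=
  ∀ S > (0:ℝ), ∀ x₀ ∈ X, ∀ z : EuclideanSpace ℝ (Fin d),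
    ∃ y ∈ closedBall z (L * S), IsOccurrence d X S x₀ y


/-- `X` is repetitive. -/
def IsRepetitive (d : ℕ) (X : Set (EuclideanSpace ℝ (Fin d))) : Prop :=
  ∀ S > (0:ℝ), ∃ M > (0:ℝ), ∀ x₀ ∈ X, ∀ z : EuclideanSpace ℝ (Fin d),
    ∃ y ∈ closedBall z M, IsOccurrence d X S x₀ y

theorem isOccurrence_iff {d : ℕ} {X : Set (EuclideanSpace ℝ (Fin d))} {S : ℝ}
    {x₀ y : EuclideanSpace ℝ (Fin d)} :
    IsOccurrence d X S x₀ y ↔ ∀ v, ‖v‖ ≤ S → (y + v ∈ X ↔ x₀ + v ∈ X) := by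
  unfold IsOccurrence
  constructor
  · intro h v hv
    have hmem := Set.ext_iff.mp h (y + v)
    constructor
    · intro hy
      obtain ⟨u, hu, hue⟩ := hmem.mp ⟨hy, by simpa using hv⟩
      have huv : u = x₀ + v := by
        have hsub : u - x₀ = v := add_right_cancel (hue.trans (add_comm y v))
        rw [← hsub]; abel
      exact huv ▸ hu.1
    · intro hx
      exact (hmem.mpr ⟨x₀ + v, ⟨hx, by simpa using hv⟩, by simp [add_comm]⟩).1
  · intro h
    ext u
    constructor
    · rintro ⟨hu, hball⟩
      have hn : ‖u - y‖ ≤ S := mem_closedBall_iff_norm.mp hball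
      exact ⟨x₀ + (u - y), ⟨(h _ hn).mp (by simpa using hu), by simpa using hn⟩, by simp⟩
    · rintro ⟨w, ⟨hw, hball⟩, rfl⟩
      have hn : ‖w - x₀‖ ≤ S := mem_closedBall_iff_norm.mp hball
      refine ⟨?_, by simpa using hn⟩
      simpa [add_comm] using (h _ hn).mpr (by simpa using hw)

theorem IsOccurrence.mem {d : ℕ} {X : Set (EuclideanSpace ℝ (Fin d))} {S : ℝ} (hS : 0 ≤ S)
    {x₀ y : EuclideanSpace ℝ (Fin d)} (hx₀ : x₀ ∈ X) (h : IsOccurrence d X S x₀ y) : y ∈ X := by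
  simpa [hx₀] using isOccurrence_iff.mp h 0 (by simpa using hS)

/-- An occurrence of a `T + S`-patch of `X` is an occurrence of the `T`-patch, with the same center,
of the set of occurrences of any `S`-patch. -/
theorem IsOccurrence.setOf_isOccurrence {d : ℕ} {X : Set (EuclideanSpace ℝ (Fin d))} {S T : ℝ}
    {x₀ y₀ y : EuclideanSpace ℝ (Fin d)} (h : IsOccurrence d X (T + S) y₀ y) :
    IsOccurrence d {y | IsOccurrence d X S x₀ y} T y₀ y := by
  rw [isOccurrence_iff] at h ⊢
  intro v hv
  simp only [mem_ofPred_eq, isOccurrence_iff]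
  refine forall_congr' fun w => imp_congr_right fun hw => ?_
  rw [add_assoc, add_assoc, h (v + w) ((norm_add_le v w).trans (add_le_add hv hw))]

theorem occurrences_form_repetitive_delone_set (d : ℕ) (hd : 1 ≤ d)
    (X : Set (EuclideanSpace ℝ (Fin d)))
    (hDelone : IsDelone d X) (hRep : IsRepetitive d X)
    (S : ℝ) (hS : 0 < S) (x₀ : EuclideanSpace ℝ (Fin d)) (hx₀ : x₀ ∈ X) :
    IsDelone d {y | IsOccurrence d X S x₀ y} ∧
      IsRepetitive d {y | IsOccurrence d X S x₀ y} := by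
  refine ⟨⟨?_, ?_⟩, ?_⟩
  · obtain ⟨r, hr, hdisc⟩ := hDelone.1
    exact ⟨r, hr, fun z => (hdisc z).anti fun y hy => ⟨IsOccurrence.mem hS.le hx₀ hy.1, hy.2⟩⟩
  · obtain ⟨M, hM, hocc⟩ := hRep S hS
    refine ⟨M, hM, fun z => ?_⟩
    obtain ⟨y, hy, hy'⟩ := hocc x₀ hx₀ z
    exact ⟨y, hy', hy⟩
  · intro T hT
    obtain ⟨M, hM, hocc⟩ := hRep (T + S) (add_pos hT hS)
    refine ⟨M, hM, fun y₀ hy₀ z => ?_⟩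
    obtain ⟨y, hy, hy'⟩ := hocc y₀ (IsOccurrence.mem hS.le hx₀ hy₀) z
    exact ⟨y, hy, hy'.setOf_isOccurrence⟩
end

section
/- Let d ≥ 1 and let Y ⊆ ℝ^d be a Delone set that is R-dense for some R > 0. Then the Voronoi cell of a point of Y is determined by its 2R-patch: if y, y′ ∈ Y satisfy (Y ∩ B̄_{2R}(y)) − y = (Y ∩ B̄_{2R}(y′)) − y′, then 𝒱_y(Y) − y = 𝒱_{y′}(Y) − y′. -/
open Metric Set

/-- The Voronoi cell of `y` in `Y`. -/
def voronoiCell (d : ℕ) (Y : Set (EuclideanSpace ℝ (Fin d)))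
    (y : EuclideanSpace ℝ (Fin d)) : Set (EuclideanSpace ℝ (Fin d)) :=
  {z | ∀ y' ∈ Y, dist z y ≤ dist z y'}

/-- A point of the Voronoi cell of `y` lies within distance `R` of `y` if `Y` is `R`-dense. -/
theorem dist_le_of_mem_voronoiCell {d : ℕ} {R : ℝ} {Y : Set (EuclideanSpace ℝ (Fin d))}
    (hdense : IsRDense d R Y) {y z : EuclideanSpace ℝ (Fin d)} (hz : z ∈ voronoiCell d Y y) :
    dist z y ≤ R := by
  obtain ⟨u, huY, hu⟩ := hdense z
  exact (hz u huY).trans (mem_closedBall'.1 hu)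

/-- If the `2R`-patch at `y'` is contained in the `2R`-patch at `y` up to translation, then the
Voronoi cell of `y` is contained in the Voronoi cell of `y'` up to translation. -/
theorem image_sub_voronoiCell_subset {d : ℕ} {R : ℝ} {Y : Set (EuclideanSpace ℝ (Fin d))}
    (hdense : IsRDense d R Y) {y y' : EuclideanSpace ℝ (Fin d)}
    (hpatch : (fun w => w - y') '' (Y ∩ closedBall y' (2 * R)) ⊆
        (fun w => w - y) '' (Y ∩ closedBall y (2 * R))) :
    (fun w => w - y) '' voronoiCell d Y y ⊆ (fun w => w - y') '' voronoiCell d Y y' := by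
  rintro _ ⟨z, hz, rfl⟩
  have hzR : dist z y ≤ R := dist_le_of_mem_voronoiCell hdense hz
  refine ⟨z - y + y', fun u hu => ?_, add_sub_cancel_right _ _⟩
  have hdist : dist (z - y + y') y' = dist z y := by simp [dist_eq_norm]
  rw [hdist]
  rcases le_or_gt (dist u y') (2 * R) with hnear | hfar
  · obtain ⟨w, ⟨hwY, -⟩, hw⟩ := hpatch ⟨u, ⟨hu, hnear⟩, rfl⟩
    have hw' : w - y = u - y' := hw
    have hzw : z - y + y' - u = z - w := by
      rw [← sub_add_cancel u y', ← hw']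
      abel
    rw [dist_eq_norm (z - y + y') u, hzw, ← dist_eq_norm]
    exact hz w hwY
  · have htri := dist_triangle_left u y' (z - y + y')
    linarith

theorem voronoiCell_locally_determined (d : ℕ) (hd : 1 ≤ d)
    (Y : Set (EuclideanSpace ℝ (Fin d))) (hDelone : IsDelone d Y)
    (R : ℝ) (hR : 0 < R) (hdense : IsRDense d R Y)
    (y y' : EuclideanSpace ℝ (Fin d)) (hy : y ∈ Y) (hy' : y' ∈ Y)
    (hpatch : (fun w => w - y) '' (Y ∩ closedBall y (2 * R)) =
        (fun w => w - y') '' (Y ∩ closedBall y' (2 * R))) :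
    (fun w => w - y) '' voronoiCell d Y y = (fun w => w - y') '' voronoiCell d Y y' := by
  exact (image_sub_voronoiCell_subset hdense hpatch.ge).antisymm
    (image_sub_voronoiCell_subset hdense hpatch.le)
end

section
/- Let (t_n)_{n≥0} be a sequence of positive integers and let 0 ≤ c < 1. For each n ≥ 1 let Q_n be a real t_{n−1} × t_n matrix whose entries are nonnegative, whose rows each sum to 1, and all of whose entries are ≥ 1 − c. For n > m ≥ 0 let Q(n,m) = Q_{m+1} Q_{m+2} ⋯ Q_n (a t_m × t_n matrix). Then for all n > m ≥ 0, all i, j ∈ {1, …, t_m} and all s ∈ {1, …, t_n}: |Q(n,m)_{i,s} − Q(n,m)_{j,s}| ≤ c^{n−m}. -/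
/-- The product `Q (m) * Q (m+1) * ⋯ * Q (m+k-1)` of the matrices `Q`,
mapping level `m` to level `m + k` (the empty product is the identity). -/
noncomputable def Qprod (t : ℕ → ℕ) (Q : ∀ n, Matrix (Fin (t n)) (Fin (t (n + 1))) ℝ)
    (m : ℕ) : (k : ℕ) → Matrix (Fin (t m)) (Fin (t (m + k))) ℝ
  | 0 => (1 : Matrix (Fin (t m)) (Fin (t m)) ℝ)
  | k + 1 => Qprod t Q m k * Q (m + k)

/-- If the entries of the row-stochastic matrix `A` are at least `1 - c`, then `A` contracts the
oscillation of vectors by the factor `c`. -/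
theorem mulVec_sub_le_of_row_stochastic {ι κ : Type*} [Fintype κ] [Nonempty κ]
    {c D : ℝ} {A : Matrix ι κ ℝ} (hnonneg : ∀ i s, 0 ≤ A i s) (hrow : ∀ i, ∑ s, A i s = 1)
    (hlow : ∀ i s, 1 - c ≤ A i s) {f : κ → ℝ} (hf : ∀ x y, f x - f y ≤ D) (i j : ι) :
    A.mulVec f i - A.mulVec f j ≤ c * D := by
  classical
  obtain ⟨x₀, hx₀⟩ := Finite.exists_min f
  have hD : 0 ≤ D := by simpa using hf x₀ x₀
  have shift (k : ι) : A.mulVec f k = ∑ s, A k s * (f s - f x₀) + f x₀ := by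
    simp [Matrix.mulVec, dotProduct, mul_sub, Finset.sum_sub_distrib, ← Finset.sum_mul, hrow]
  have lower : 0 ≤ ∑ s, A j s * (f s - f x₀) :=
    Finset.sum_nonneg fun s _ => mul_nonneg (hnonneg j s) (sub_nonneg.2 (hx₀ s))
  have upper : ∑ s, A i s * (f s - f x₀) ≤ c * D := calc
    ∑ s, A i s * (f s - f x₀) ≤ ∑ s, (A i s * D - if s = x₀ then A i s * D else 0) := by
      refine Finset.sum_le_sum fun s _ => ?_
      split_ifs with h
      · simp [h]
      · simpa using mul_le_mul_of_nonneg_left (hf s x₀) (hnonneg i s)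
    _ = (1 - A i x₀) * D := by
      simp [Finset.sum_sub_distrib, ← Finset.sum_mul, hrow, sub_mul]
    _ ≤ c * D := mul_le_mul_of_nonneg_right (by linarith [hlow i x₀]) hD
  rw [shift i, shift j]
  linarith

/-- A product of `k` row-stochastic matrices with entries at least `1 - c` contracts the
oscillation of vectors by the factor `c ^ k`. -/
theorem Qprod_mulVec_sub_le {t : ℕ → ℕ} (ht : ∀ n, 0 < t n) {c : ℝ}
    {Q : ∀ n, Matrix (Fin (t n)) (Fin (t (n + 1))) ℝ}
    (hnonneg : ∀ n i s, 0 ≤ Q n i s) (hrow : ∀ n i, ∑ s, Q n i s = 1)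
    (hlow : ∀ n i s, 1 - c ≤ Q n i s) (m k : ℕ) {D : ℝ} {f : Fin (t (m + k)) → ℝ}
    (hf : ∀ x y, f x - f y ≤ D) (i j : Fin (t m)) :
    (Qprod t Q m k).mulVec f i - (Qprod t Q m k).mulVec f j ≤ c ^ k * D := by
  induction k generalizing D with
  | zero =>
    have h : (Qprod t Q m 0).mulVec f = f := Matrix.one_mulVec f
    rw [h, pow_zero, one_mul]
    exact hf i j
  | succ k ih =>
    have h : (Qprod t Q m (k + 1)).mulVec f = (Qprod t Q m k).mulVec ((Q (m + k)).mulVec f) :=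
      (Matrix.mulVec_mulVec f _ _).symm
    have : Nonempty (Fin (t (m + k + 1))) := ⟨⟨0, ht _⟩⟩
    rw [h, pow_succ, mul_assoc]
    exact ih (mulVec_sub_le_of_row_stochastic (hnonneg _) (hrow _) (hlow _) hf)

theorem stochastic_product_contraction (t : ℕ → ℕ) (ht : ∀ n, 0 < t n)
    (c : ℝ) (hc0 : 0 ≤ c) (hc1 : c < 1)
    (Q : ∀ n, Matrix (Fin (t n)) (Fin (t (n + 1))) ℝ)
    (hnonneg : ∀ n i s, 0 ≤ Q n i s)
    (hrow : ∀ n i, ∑ s, Q n i s = 1)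
    (hlow : ∀ n i s, 1 - c ≤ Q n i s) :
    ∀ m k : ℕ, 1 ≤ k → ∀ (i j : Fin (t m)) (s : Fin (t (m + k))),
      |Qprod t Q m k i s - Qprod t Q m k j s| ≤ c ^ k := by
  intro m k _ i j s
  have hf : ∀ x y, (Pi.single s 1 : Fin (t (m + k)) → ℝ) x - (Pi.single s 1 : _ → ℝ) y ≤ 1 := by
    intro x y
    simp only [Pi.single_apply]
    split_ifs <;> norm_num
  have h := Qprod_mulVec_sub_le ht hnonneg hrow hlow m k hf
  simp only [Matrix.mulVec_single_one, Matrix.col_apply, mul_one] at h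
  exact abs_sub_le_iff.2 ⟨h i j, h j i⟩
end

section
/- Let t₀, t, t′ ≥ 1 be integers, let M be a t × t₀ real matrix and M′ a t′ × t real matrix, all of whose entries are ≥ 1. Let ν⁰ ∈ ℝ^{t₀}, ν ∈ ℝ^{t} and ν′ ∈ ℝ^{t′} have strictly positive entries and satisfy ν⁰_j = Σ_{i=1}^{t} ν_i M_{i,j} for all j ∈ {1,…,t₀} and ν_k = Σ_{i=1}^{t′} ν′_i M′_{i,k} for all k ∈ {1,…,t}. Then for all i ∈ {1,…,t} and j ∈ {1,…,t₀}: (ν_i · M_{i,j}) / ν⁰_j ≥ (‖M‖₁ · ‖M′‖₁)^{−1}. -/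
/-- `‖A‖₁`: the maximum absolute column sum of the matrix `A`. -/
noncomputable def colNorm {a b : ℕ} (A : Matrix (Fin a) (Fin b) ℝ) : ℝ :=
  ⨆ j : Fin b, ∑ i : Fin a, |A i j|

theorem sum_abs_le_colNorm {a b : ℕ} (A : Matrix (Fin a) (Fin b) ℝ) (j : Fin b) :
    ∑ i, |A i j| ≤ colNorm A :=
  le_ciSup (f := fun j => ∑ i, |A i j|) (Set.finite_range _).bddAbove j

theorem abs_apply_le_colNorm {a b : ℕ} (A : Matrix (Fin a) (Fin b) ℝ) (i : Fin a) (j : Fin b) :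
    |A i j| ≤ colNorm A :=
  (Finset.single_le_sum (f := fun i => |A i j|) (fun _ _ => abs_nonneg _)
    (Finset.mem_univ i)).trans (sum_abs_le_colNorm A j)

theorem colNorm_nonneg {a b : ℕ} (A : Matrix (Fin a) (Fin b) ℝ) : 0 ≤ colNorm A :=
  Real.iSup_nonneg fun _ => Finset.sum_nonneg fun _ _ => abs_nonneg _

/-- If all entries of `A` are at least `1`, any two coordinates of the image of a nonnegative
row vector under `A` are comparable up to the factor `colNorm A`. -/
theorem sum_mul_le_colNorm_mul_sum_mul {a b : ℕ} {A : Matrix (Fin a) (Fin b) ℝ}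
    (hA : ∀ i j, 1 ≤ A i j) {w : Fin a → ℝ} (hw : ∀ i, 0 ≤ w i) (k l : Fin b) :
    ∑ i, w i * A i k ≤ colNorm A * ∑ i, w i * A i l := by
  rw [Finset.mul_sum]
  refine Finset.sum_le_sum fun i _ => ?_
  calc w i * A i k ≤ w i * colNorm A :=
        mul_le_mul_of_nonneg_left ((le_abs_self _).trans (abs_apply_le_colNorm A i k)) (hw i)
    _ = colNorm A * w i := mul_comm _ _
    _ ≤ colNorm A * (w i * A i l) :=
        mul_le_mul_of_nonneg_left (le_mul_of_one_le_right (hw i) (hA i l)) (colNorm_nonneg A)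

theorem transition_probability_lower_bound (t₀ t t' : ℕ)
    (ht₀ : 1 ≤ t₀) (ht : 1 ≤ t) (ht' : 1 ≤ t')
    (M : Matrix (Fin t) (Fin t₀) ℝ) (M' : Matrix (Fin t') (Fin t) ℝ)
    (hM : ∀ i j, 1 ≤ M i j) (hM' : ∀ i j, 1 ≤ M' i j)
    (ν₀ : Fin t₀ → ℝ) (ν : Fin t → ℝ) (ν' : Fin t' → ℝ)
    (hν₀ : ∀ j, 0 < ν₀ j) (hν : ∀ i, 0 < ν i) (hν' : ∀ i, 0 < ν' i)
    (h₁ : ∀ j, ν₀ j = ∑ i, ν i * M i j)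
    (h₂ : ∀ k, ν k = ∑ i, ν' i * M' i k) :
    ∀ (i : Fin t) (j : Fin t₀), (colNorm M * colNorm M')⁻¹ ≤ ν i * M i j / ν₀ j := by
  intro i j
  have hcomp : ∀ k, ν k ≤ colNorm M' * ν i := fun k => by
    rw [h₂ k, h₂ i]
    exact sum_mul_le_colNorm_mul_sum_mul hM' (fun l => (hν' l).le) k i
  have hle : ν₀ j ≤ colNorm M * colNorm M' * (ν i * M i j) := by
    have hnonneg : 0 ≤ colNorm M' * ν i := mul_nonneg (colNorm_nonneg M') (hν i).le
    calc ν₀ j = ∑ k, ν k * M k j := h₁ j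
      _ ≤ ∑ k, colNorm M' * ν i * |M k j| := Finset.sum_le_sum fun k _ =>
          mul_le_mul (hcomp k) (le_abs_self _) (zero_le_one.trans (hM k j)) hnonneg
      _ = colNorm M' * ν i * ∑ k, |M k j| := (Finset.mul_sum _ _ _).symm
      _ ≤ colNorm M' * ν i * colNorm M :=
          mul_le_mul_of_nonneg_left (sum_abs_le_colNorm M j) hnonneg
      _ = colNorm M * colNorm M' * ν i := by ring
      _ ≤ colNorm M * colNorm M' * (ν i * M i j) :=
          mul_le_mul_of_nonneg_left (le_mul_of_one_le_right (hν i).le (hM i j))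
            (mul_nonneg (colNorm_nonneg M) (colNorm_nonneg M'))
  have hpos : 0 < colNorm M * colNorm M' :=
    pos_of_mul_pos_left ((hν₀ j).trans_le hle)
      (mul_nonneg (hν i).le (zero_le_one.trans (hM i j)))
  rw [le_div_iff₀ (hν₀ j), inv_mul_le_iff₀ hpos]
  exact hle
end

section
/- Let d ≥ 1 and let 0 < K₁ ≤ K₂. Then there exists a constant M > 0, depending only on d, K₁ and K₂, with the following property: for all reals s, N > 0 with K₁·s ≤ N, for every d-cube U = x + [0,N]^d, and for every finite family 𝒜 of subsets of ℝ^d with pairwise disjoint interiors such that every T ∈ 𝒜 contains a closed ball of radius K₁·s, is contained in some closed ball of radius K₂·s, intersects U, and is not contained in U, the cardinality of 𝒜 satisfies #𝒜 ≤ M · N^{d−1} · s^{1−d}. -/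
open Metric Set

/-- the `d`-cube of side `N` based at `x`, i.e. `x + [0,N]^d`. -/
def cube (d : ℕ) (x : EuclideanSpace ℝ (Fin d)) (N : ℝ) : Set (EuclideanSpace ℝ (Fin d)) :=
  {y | ∀ i : Fin d, y i - x i ∈ Icc (0:ℝ) N}

open MeasureTheory

/-- The axis-parallel box with lower corner `l` and side lengths `w`. -/
def axisBox {ι : Type*} (l w : ι → ℝ) : Set (EuclideanSpace ℝ ι) :=
  {y | ∀ j, y j ∈ Icc (l j) (l j + w j)}

theorem volume_axisBox {ι : Type*} [Fintype ι] (l w : ι → ℝ) :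
    volume (axisBox l w) = ∏ j, ENNReal.ofReal (w j) := by
  have h : axisBox l w = (WithLp.ofLp : EuclideanSpace ℝ ι → ι → ℝ) ⁻¹'
      Icc l (fun j => l j + w j) := by
    ext y
    simp only [axisBox, mem_ofPred_eq, mem_preimage, mem_Icc, Pi.le_def, forall_and]
  rw [h, (PiLp.volume_preserving_ofLp ι).measure_preimage measurableSet_Icc.nullMeasurableSet,
    Real.volume_Icc_pi]
  simp

/-- The slab of half-width `R` around one of the two faces, orthogonal to direction `i`, of the cube
of side `N` based at `x`. -/
def faceSlab {ι : Type*} [DecidableEq ι] (x : ι → ℝ) (N R : ℝ) (f : ι × Bool) :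
    Set (EuclideanSpace ℝ ι) :=
  axisBox (fun j => x j - R + if j = f.1 ∧ f.2 then N else 0)
    (fun j => if j = f.1 then 2 * R else N + 2 * R)

theorem volume_faceSlab {ι : Type*} [Fintype ι] [DecidableEq ι] (x : ι → ℝ) {N R : ℝ}
    (hN : 0 ≤ N) (hR : 0 ≤ R) (f : ι × Bool) :
    volume (faceSlab x N R f) =
      ENNReal.ofReal (2 * R * (N + 2 * R) ^ (Fintype.card ι - 1)) := by
  rw [faceSlab, volume_axisBox, ← ENNReal.ofReal_prod_of_nonneg
    (fun j _ => by split_ifs <;> positivity),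
    ← Finset.mul_prod_erase _ _ (Finset.mem_univ f.1),
    Finset.prod_congr rfl (fun j hj => if_neg (Finset.ne_of_mem_erase hj))]
  simp [Finset.card_erase_of_mem]

theorem subset_iUnion_faceSlab {d : ℕ} {x : EuclideanSpace ℝ (Fin d)} {N R : ℝ}
    {T : Set (EuclideanSpace ℝ (Fin d))} (hT : ∀ u ∈ T, ∀ v ∈ T, dist u v ≤ R)
    (hmeet : (T ∩ cube d x N).Nonempty) (hout : ¬ T ⊆ cube d x N) :
    T ⊆ ⋃ f : Fin d × Bool, faceSlab x N R f := by
  obtain ⟨u, huT, hu⟩ := hmeet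
  obtain ⟨v, hvT, hv⟩ := not_subset.1 hout
  obtain ⟨i, hi⟩ : ∃ i, v i - x i ∉ Icc 0 N := by simpa [cube] using hv
  have hcoord : ∀ a ∈ T, ∀ b ∈ T, ∀ j, |a j - b j| ≤ R := fun a ha b hb j => by
    have h := (PiLp.norm_apply_le (a - b) j).trans ((dist_eq_norm a b).symm.le.trans (hT a ha b hb))
    simpa using h
  intro y hy
  refine mem_iUnion.2 ⟨(i, decide (x i ≤ v i)), fun j => ?_⟩
  have h₁ := abs_le.1 (hcoord y hy u huT j)
  have h₂ := abs_le.1 (hcoord y hy v hvT j)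
  have h₃ := hu j
  simp only [mem_Icc, not_and_or, not_le] at hi h₃ ⊢
  by_cases hj : j = i
  · subst hj
    by_cases hx : x j ≤ v j
    · have : N < v j - x j := hi.resolve_left (by linarith)
      simp only [hx, decide_true, and_self, if_true]
      constructor <;> linarith
    · simp only [hx, decide_false, Bool.false_eq_true, and_false, if_true, if_false]
      constructor <;> linarith
  · simp only [hj, false_and, if_false]
    constructor <;> linarith

theorem card_mul_measure_ball_le {ι E : Type*} [NormedAddCommGroup E] [NormedSpace ℝ E]
    [MeasurableSpace E] [BorelSpace E] [FiniteDimensional ℝ E] (μ : Measure E) [μ.IsAddHaarMeasure]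
    (A : Finset ι) (S : ι → Set E) (hdisj : (A : Set ι).Pairwise fun i j =>
      Disjoint (interior (S i)) (interior (S j))) {r : ℝ}
    (hball : ∀ i ∈ A, ∃ c, ball c r ⊆ S i) {W : Set E} (hW : ∀ i ∈ A, S i ⊆ W) :
    A.card * μ (ball 0 r) ≤ μ W := by
  calc A.card * μ (ball 0 r) ≤ ∑ i ∈ A, μ (interior (S i)) := by
        rw [← nsmul_eq_mul]
        refine Finset.card_nsmul_le_sum _ _ _ fun i hi => ?_
        obtain ⟨c, hc⟩ := hball i hi
        rw [← Measure.addHaar_ball_center μ c r]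
        exact measure_mono (interior_maximal hc isOpen_ball)
    _ = μ (⋃ i ∈ A, interior (S i)) :=
        (measure_biUnion_finset hdisj fun i _ => isOpen_interior.measurableSet).symm
    _ ≤ μ W := measure_mono (iUnion₂_subset fun i hi => interior_subset.trans (hW i hi))

theorem card_mul_volume_ball_le_slabs {d : ℕ} {r R N : ℝ} (hr : 0 < r) (hR : 0 ≤ R)
    (hN : 0 ≤ N) (x : EuclideanSpace ℝ (Fin d)) (A : Finset (Set (EuclideanSpace ℝ (Fin d))))
    (hdisj : (A : Set (Set (EuclideanSpace ℝ (Fin d)))).Pairwise fun T T' =>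
      Disjoint (interior T) (interior T'))
    (hA : ∀ T ∈ A, (∃ c, closedBall c r ⊆ T) ∧ (∀ u ∈ T, ∀ v ∈ T, dist u v ≤ R) ∧
      (T ∩ cube d x N).Nonempty ∧ ¬ T ⊆ cube d x N) :
    A.card * (r ^ d * volume.real (ball (0 : EuclideanSpace ℝ (Fin d)) 1)) ≤
      2 * d * (2 * R * (N + 2 * R) ^ (d - 1)) := by
  have hcount := card_mul_measure_ball_le volume A id hdisj
    (fun T hT => (hA T hT).1.imp fun c hc => ball_subset_closedBall.trans hc)
    (fun T hT => subset_iUnion_faceSlab (hA T hT).2.1 (hA T hT).2.2.1 (hA T hT).2.2.2)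
  have hslabs : volume (⋃ f : Fin d × Bool, faceSlab x N R f) ≤
      ENNReal.ofReal (2 * d * (2 * R * (N + 2 * R) ^ (d - 1))) := by
    refine (measure_iUnion_fintype_le _ _).trans_eq ?_
    simp only [volume_faceSlab (ι := Fin d) _ hN hR]
    rw [← ENNReal.ofReal_sum_of_nonneg fun _ _ => by positivity]
    simp [mul_comm]
  have h := ENNReal.toReal_le_of_le_ofReal (by positivity) (hcount.trans hslabs)
  rwa [ENNReal.toReal_mul, Measure.addHaar_ball_of_pos volume _ hr, ENNReal.toReal_mul,
    ENNReal.toReal_ofReal (by positivity), finrank_euclideanSpace_fin,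
    ENNReal.toReal_natCast] at h

theorem boundary_tiles_count (d : ℕ) (hd : 1 ≤ d) (K₁ K₂ : ℝ) (hK₁ : 0 < K₁) (hK : K₁ ≤ K₂) :
    ∃ M > (0:ℝ), ∀ s N : ℝ, 0 < s → 0 < N → K₁ * s ≤ N →
      ∀ x : EuclideanSpace ℝ (Fin d), ∀ A : Finset (Set (EuclideanSpace ℝ (Fin d))),
        ((A : Set (Set (EuclideanSpace ℝ (Fin d)))).Pairwise fun T T' =>
          Disjoint (interior T) (interior T')) →
        (∀ T ∈ A, (∃ c, closedBall c (K₁ * s) ⊆ T) ∧ (∃ c, T ⊆ closedBall c (K₂ * s)) ∧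
          (T ∩ cube d x N).Nonempty ∧ ¬ T ⊆ cube d x N) →
        (A.card : ℝ) ≤ M * N ^ ((d:ℝ) - 1) * s ^ (1 - (d:ℝ)) := by
  have hK₂ : 0 < K₂ := hK₁.trans_le hK
  set b := volume.real (ball (0 : EuclideanSpace ℝ (Fin d)) 1)
  have hb0 : 0 < b := ENNReal.toReal_pos (measure_ball_pos _ _ one_pos).ne' measure_ball_lt_top.ne
  have hd0 : (0:ℝ) < d := by exact_mod_cast hd
  refine ⟨8 * d * K₂ * (1 + 4 * K₂ / K₁) ^ (d - 1) / (K₁ ^ d * b), by positivity, ?_⟩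
  intro s N hs hN hsN x A hdisj hA
  have hcount := card_mul_volume_ball_le_slabs (r := K₁ * s) (R := 2 * (K₂ * s))
    (by positivity) (by positivity) hN.le x A hdisj fun T hT => by
      obtain ⟨h₁, ⟨c, hc⟩, h₂⟩ := hA T hT
      refine ⟨h₁, fun u hu v hv => ?_, h₂⟩
      linarith [dist_triangle_right u v c, mem_closedBall.1 (hc hu), mem_closedBall.1 (hc hv)]
  have hwidth : N + 2 * (2 * (K₂ * s)) ≤ (1 + 4 * K₂ / K₁) * N := by
    have : 4 * K₂ / K₁ * (K₁ * s) ≤ 4 * K₂ / K₁ * N := by gcongr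
    have h : 4 * K₂ / K₁ * (K₁ * s) = 4 * K₂ * s := by field_simp
    linarith
  have hpow : (N + 2 * (2 * (K₂ * s))) ^ (d - 1) ≤ (1 + 4 * K₂ / K₁) ^ (d - 1) * N ^ (d - 1) := by
    rw [← mul_pow]
    gcongr
  rw [show (1 - (d:ℝ)) = -((d - 1 : ℕ) : ℝ) by push_cast [hd]; ring,
    show ((d:ℝ) - 1) = ((d - 1 : ℕ) : ℝ) by push_cast [hd]; ring,
    Real.rpow_neg hs.le, Real.rpow_natCast, Real.rpow_natCast]
  obtain ⟨n, rfl⟩ : ∃ n, d = n + 1 := ⟨d - 1, by omega⟩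
  simp only [Nat.add_sub_cancel] at hcount hpow ⊢
  rw [div_mul_eq_mul_div, ← div_eq_mul_inv, div_div, le_div_iff₀ (by positivity)]
  refine le_of_mul_le_mul_right ?_ hs
  calc _ = A.card * ((K₁ * s) ^ (n + 1) * b) := by ring
    _ ≤ _ := hcount
    _ ≤ 2 * ((n + 1 : ℕ) : ℝ) * (2 * (2 * (K₂ * s)) *
        ((1 + 4 * K₂ / K₁) ^ n * N ^ n)) := by gcongr
    _ = _ := by ring
end

section
/- Let d ≥ 1 and let Y ⊆ ℝ^d be a Delone set. For a subset D ⊆ ℝ^d define D* = {p ∈ ℝ^d : there exists ε₀ > 0 such that p + (ε, ε², …, ε^d) ∈ D for all ε ∈ (0, ε₀)}. Then the family {𝒱_y(Y)* : y ∈ Y} of starred Voronoi cells is a partition of ℝ^d: for y ≠ y′ in Y the sets 𝒱_y(Y)* and 𝒱_{y′}(Y)* are disjoint, and every point of ℝ^d belongs to 𝒱_y(Y)* for some y ∈ Y. -/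
open Metric Set

/-- The star `D*` of a set `D`: points `p` such that `p + (ε, ε², …, ε^d)` belongs to `D`
for all sufficiently small `ε > 0`. -/
def starSet (d : ℕ) (D : Set (EuclideanSpace ℝ (Fin d))) : Set (EuclideanSpace ℝ (Fin d)) :=
  {p | ∃ ε₀ > (0:ℝ), ∀ ε : ℝ, 0 < ε → ε < ε₀ →
    p + (EuclideanSpace.equiv (Fin d) ℝ).symm (fun i : Fin d => ε ^ ((i : ℕ) + 1)) ∈ D}

open Filter Topology Polynomial in
/-- A nonzero real polynomial has constant sign immediately to the right of `0`. -/
theorem Polynomial.eventually_pos_or_eventually_neg_nhdsGT_zero {P : ℝ[X]} (hP : P ≠ 0) :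
    (∀ᶠ x in 𝓝[>] (0 : ℝ), 0 < P.eval x) ∨ (∀ᶠ x in 𝓝[>] (0 : ℝ), P.eval x < 0) := by
  obtain ⟨q, hq, hnd⟩ := P.exists_eq_pow_rootMultiplicity_mul_and_not_dvd hP 0
  rw [dvd_iff_isRoot, IsRoot.def] at hnd
  have hcont : Tendsto (fun x => q.eval x) (𝓝[>] 0) (𝓝 (q.eval 0)) :=
    q.continuous.continuousAt.tendsto.mono_left nhdsWithin_le_nhds
  have hev (x : ℝ) : P.eval x = x ^ P.rootMultiplicity 0 * q.eval x := by
    conv_lhs => rw [hq]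
    simp
  rcases lt_or_gt_of_ne hnd with h | h
  · right
    filter_upwards [hcont.eventually_lt_const h, self_mem_nhdsWithin] with x hx hx0
    rw [hev]
    exact mul_neg_of_pos_of_neg (pow_pos hx0 _) hx
  · left
    filter_upwards [hcont.eventually_const_lt h, self_mem_nhdsWithin] with x hx hx0
    rw [hev]
    exact mul_pos (pow_pos hx0 _) hx

/-- The moment curve `ε ↦ (ε, ε², …, ε^d)`. -/
noncomputable def momentCurve (d : ℕ) (ε : ℝ) : EuclideanSpace ℝ (Fin d) :=
  (EuclideanSpace.equiv (Fin d) ℝ).symm (fun i : Fin d => ε ^ ((i : ℕ) + 1))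

theorem momentCurve_apply (d : ℕ) (ε : ℝ) (i : Fin d) :
    momentCurve d ε i = ε ^ ((i : ℕ) + 1) := rfl

theorem continuous_momentCurve (d : ℕ) : Continuous (momentCurve d) :=
  (EuclideanSpace.equiv (Fin d) ℝ).symm.continuous.comp (by fun_prop)

theorem momentCurve_zero (d : ℕ) : momentCurve d 0 = 0 := by
  ext i
  simp [momentCurve_apply]

open Filter Topology in
theorem mem_starSet_iff_eventually {d : ℕ} {D : Set (EuclideanSpace ℝ (Fin d))}
    {p : EuclideanSpace ℝ (Fin d)} :
    p ∈ starSet d D ↔ ∀ᶠ ε in 𝓝[>] (0 : ℝ), p + momentCurve d ε ∈ D := by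
  rw [(nhdsGT_basis (0 : ℝ)).eventually_iff]
  simp only [starSet, momentCurve, Set.mem_ofPred_eq, Set.mem_Ioo, and_imp, gt_iff_lt]

open Polynomial in
/-- The difference of the squared distances from the translated moment curve to two points is
polynomial in the parameter, and it is nonzero if the points differ. -/
theorem exists_polynomial_eval_eq_dist_sq_sub {d : ℕ} (p : EuclideanSpace ℝ (Fin d))
    {y z : EuclideanSpace ℝ (Fin d)} (hyz : y ≠ z) :
    ∃ P : ℝ[X], P ≠ 0 ∧ ∀ ε : ℝ,
      P.eval ε = dist (p + momentCurve d ε) z ^ 2 - dist (p + momentCurve d ε) y ^ 2 := by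
  refine ⟨C (dist p z ^ 2 - dist p y ^ 2) +
    ∑ i : Fin d, C (2 * (y i - z i)) * X ^ ((i : ℕ) + 1), fun h => hyz ?_, fun ε => ?_⟩
  · ext i
    have hi := congrArg (fun Q : ℝ[X] => Q.coeff ((i : ℕ) + 1)) h
    simp only [coeff_add, coeff_C_succ, finsetSum_coeff, coeff_C_mul, coeff_X_pow,
      add_left_inj, Fin.val_inj, coeff_zero, mul_ite, mul_one, mul_zero, zero_add,
      Finset.sum_ite_eq, Finset.mem_univ, if_true] at hi
    linarith
  · simp only [eval_add, eval_C, eval_finsetSum, eval_mul, eval_pow, eval_X,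
      EuclideanSpace.dist_sq_eq, Real.dist_eq, sq_abs, PiLp.add_apply, momentCurve_apply,
      ← Finset.sum_sub_distrib, ← Finset.sum_add_distrib]
    exact Finset.sum_congr rfl fun i _ => by ring

open Filter Topology in
/-- Along the moment curve, one of two distinct points is eventually strictly closer. -/
theorem eventually_dist_lt_or_eventually_dist_lt {d : ℕ} (p : EuclideanSpace ℝ (Fin d))
    {y z : EuclideanSpace ℝ (Fin d)} (hyz : y ≠ z) :
    (∀ᶠ ε in 𝓝[>] (0 : ℝ), dist (p + momentCurve d ε) y < dist (p + momentCurve d ε) z) ∨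
    (∀ᶠ ε in 𝓝[>] (0 : ℝ), dist (p + momentCurve d ε) z < dist (p + momentCurve d ε) y) := by
  obtain ⟨P, hP, hev⟩ := exists_polynomial_eval_eq_dist_sq_sub p hyz
  refine (Polynomial.eventually_pos_or_eventually_neg_nhdsGT_zero hP).imp
    (fun h => h.mono fun ε hε => ?_) (fun h => h.mono fun ε hε => ?_) <;>
  · rw [hev] at hε
    exact lt_of_pow_lt_pow_left₀ 2 dist_nonneg (by linarith)

theorem IsRDiscrete.finite_inter_closedBall {d : ℕ} {r : ℝ}
    {Y : Set (EuclideanSpace ℝ (Fin d))} (hY : IsRDiscrete d r Y) (hr : 0 < r)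
    (p : EuclideanSpace ℝ (Fin d)) (R : ℝ) : (Y ∩ closedBall p R).Finite := by
  obtain ⟨t, -, ht, hcover⟩ := (isCompact_closedBall p R).finite_cover_balls hr
  refine (ht.biUnion fun z _ => (hY z).finite).subset fun y hy => ?_
  obtain ⟨z, hz, hyz⟩ := Set.mem_iUnion₂.1 (hcover hy.2)
  exact Set.mem_iUnion₂.2 ⟨z, hz, hy.1, ball_subset_closedBall hyz⟩

open Filter Topology in
/-- In a nonempty finite set, some point is eventually nearest along the moment curve. -/
theorem Set.Finite.exists_eventually_forall_dist_le {d : ℕ}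
    {F : Set (EuclideanSpace ℝ (Fin d))} (hF : F.Finite) (hne : F.Nonempty)
    (p : EuclideanSpace ℝ (Fin d)) :
    ∃ y ∈ F, ∀ᶠ ε in 𝓝[>] (0 : ℝ),
      ∀ z ∈ F, dist (p + momentCurve d ε) y ≤ dist (p + momentCurve d ε) z := by
  have hmin : ∃ᶠ ε in 𝓝[>] (0 : ℝ), ∃ y ∈ F,
      ∀ z ∈ F, dist (p + momentCurve d ε) y ≤ dist (p + momentCurve d ε) z :=
    Eventually.frequently (.of_forall fun ε => Set.exists_min_image F _ hF hne)
  obtain ⟨y, hy, hfreq⟩ : ∃ y ∈ F, ∃ᶠ ε in 𝓝[>] (0 : ℝ),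
      ∀ z ∈ F, dist (p + momentCurve d ε) y ≤ dist (p + momentCurve d ε) z := by
    by_contra! h
    refine hmin (((eventually_all_finite hF).2 h).mono ?_)
    rintro ε hε ⟨y, hy, hle⟩
    obtain ⟨z, hz, hlt⟩ := hε y hy
    exact hlt.not_ge (hle z hz)
  refine ⟨y, hy, (eventually_all_finite hF).2 fun z hz => ?_⟩
  rcases eq_or_ne y z with rfl | hyz
  · exact .of_forall fun _ => le_rfl
  rcases eventually_dist_lt_or_eventually_dist_lt p hyz with h | h
  · exact h.mono fun _ => le_of_lt
  · obtain ⟨ε, hε, hlt⟩ := (hfreq.and_eventually h).exists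
    exact absurd (hε z hz) hlt.not_ge

theorem starred_voronoi_cells_partition (d : ℕ) (hd : 1 ≤ d)
    (Y : Set (EuclideanSpace ℝ (Fin d))) (hDelone : IsDelone d Y) :
    (∀ y ∈ Y, ∀ y' ∈ Y, y ≠ y' →
        Disjoint (starSet d (voronoiCell d Y y)) (starSet d (voronoiCell d Y y'))) ∧
    (∀ p : EuclideanSpace ℝ (Fin d), ∃ y ∈ Y, p ∈ starSet d (voronoiCell d Y y)) := by
  refine ⟨fun y hy y' hy' hne => Set.disjoint_left.2 fun p hp hp' => ?_, fun p => ?_⟩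
  · rw [mem_starSet_iff_eventually] at hp hp'
    rcases eventually_dist_lt_or_eventually_dist_lt p hne with h | h
    · obtain ⟨ε, hlt, hle⟩ := (h.and hp').exists
      exact hlt.not_ge (hle y hy)
    · obtain ⟨ε, hlt, hle⟩ := (h.and hp).exists
      exact hlt.not_ge (hle y' hy')
  · obtain ⟨⟨r, hr, hdisc⟩, R, -, hdense⟩ := hDelone
    obtain ⟨y₀, hy₀, hpy₀⟩ := hdense p
    rw [mem_closedBall'] at hpy₀
    have hy₀F : y₀ ∈ Y ∩ closedBall p (R + 2) := ⟨hy₀, by rw [mem_closedBall']; linarith⟩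
    obtain ⟨y, hy, hev⟩ := (hdisc.finite_inter_closedBall hr p
      (R + 2)).exists_eventually_forall_dist_le ⟨y₀, hy₀F⟩ p
    refine ⟨y, hy.1, mem_starSet_iff_eventually.2 ?_⟩
    have hcont : Continuous fun ε => dist (p + momentCurve d ε) p :=
      (continuous_const.add (continuous_momentCurve d)).dist continuous_const
    have hsmall := (hcont.continuousAt (x := 0)).eventually_lt_const
      (show dist (p + momentCurve d 0) p < 1 by simp [momentCurve_zero])
    filter_upwards [hev, hsmall.filter_mono nhdsWithin_le_nhds] with ε hε hlt z hz
    by_cases hzF : dist p z ≤ R + 2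
    · exact hε z ⟨hz, mem_closedBall'.2 hzF⟩
    · have h₁ := hε y₀ hy₀F
      have h₂ := dist_triangle (p + momentCurve d ε) p y₀
      have h₃ := dist_triangle_left p z (p + momentCurve d ε)
      linarith
end

section
/- Let t₀, t, t′ ≥ 1 be integers, let M be a t × t₀ real matrix and M′ a t′ × t real matrix, all of whose entries are ≥ 1. Let u⁰ ∈ ℝ^{t₀}, u ∈ ℝ^{t}, u′ ∈ ℝ^{t′} have strictly positive entries and satisfy u_i = Σ_{j=1}^{t₀} M_{i,j} u⁰_j for all i and u′_k = Σ_{i=1}^{t} M′_{k,i} u_i for all k. Let ν ∈ ℝ^{t} and ν′ ∈ ℝ^{t′} have strictly positive entries and satisfy ν_i = Σ_{k=1}^{t′} ν′_k M′_{k,i} for all i, together with the normalization Σ_{k=1}^{t′} u′_k ν′_k = 1. Then for every i ∈ {1,…,t}: u_i · ν_i ≥ (‖M‖_∞ · ‖M′‖_∞)^{−1}. -/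
/-- `‖A‖_∞`: the maximum absolute row sum of the matrix `A`. -/
noncomputable def rowNorm {a b : ℕ} (A : Matrix (Fin a) (Fin b) ℝ) : ℝ :=
  ⨆ i : Fin a, ∑ j : Fin b, |A i j|

theorem row_sum_abs_le_rowNorm {a b : ℕ} (A : Matrix (Fin a) (Fin b) ℝ) (i : Fin a) :
    ∑ j, |A i j| ≤ rowNorm A :=
  le_ciSup (f := fun i => ∑ j, |A i j|) (Set.finite_range _).bddAbove i

/-- If every entry of `x` is at most `c ≥ 0` and the entries of `A` are nonnegative, then every
entry of `A x` is at most `‖A‖_∞ c`. -/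
theorem sum_mul_le_rowNorm_mul {a b : ℕ} {A : Matrix (Fin a) (Fin b) ℝ}
    (hA : ∀ i j, 0 ≤ A i j) {x : Fin b → ℝ} {c : ℝ} (hc : 0 ≤ c) (hx : ∀ j, x j ≤ c)
    (i : Fin a) : ∑ j, A i j * x j ≤ rowNorm A * c :=
  calc ∑ j, A i j * x j ≤ ∑ j, |A i j| * c := by
        refine Finset.sum_le_sum fun j _ => ?_
        rw [abs_of_nonneg (hA i j)]
        exact mul_le_mul_of_nonneg_left (hx j) (hA i j)
    _ = (∑ j, |A i j|) * c := (Finset.sum_mul _ _ _).symm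
    _ ≤ rowNorm A * c := by gcongr; exact row_sum_abs_le_rowNorm A i

theorem box_measure_lower_bound (t₀ t t' : ℕ)
    (ht₀ : 1 ≤ t₀) (ht : 1 ≤ t) (ht' : 1 ≤ t')
    (M : Matrix (Fin t) (Fin t₀) ℝ) (M' : Matrix (Fin t') (Fin t) ℝ)
    (hM : ∀ i j, 1 ≤ M i j) (hM' : ∀ i j, 1 ≤ M' i j)
    (u₀ : Fin t₀ → ℝ) (u : Fin t → ℝ) (u' : Fin t' → ℝ)
    (hu₀ : ∀ j, 0 < u₀ j) (hu : ∀ i, 0 < u i) (hu' : ∀ k, 0 < u' k)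
    (hvol : ∀ i, u i = ∑ j, M i j * u₀ j)
    (hvol' : ∀ k, u' k = ∑ i, M' k i * u i)
    (ν : Fin t → ℝ) (ν' : Fin t' → ℝ)
    (hν : ∀ i, 0 < ν i) (hν' : ∀ k, 0 < ν' k)
    (htr : ∀ i, ν i = ∑ k, ν' k * M' k i)
    (hnorm : ∑ k, u' k * ν' k = 1) :
    ∀ i : Fin t, (rowNorm M * rowNorm M')⁻¹ ≤ u i * ν i := by
  intro i
  have hsum : ∑ j, u₀ j ≤ u i := by
    rw [hvol]
    exact Finset.sum_le_sum fun j _ => le_mul_of_one_le_left (hu₀ j).le (hM i j)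
  have hu₀_le (j) : u₀ j ≤ u i :=
    (Finset.single_le_sum (fun j _ => (hu₀ j).le) (Finset.mem_univ j)).trans hsum
  have hu_le (l) : u l ≤ rowNorm M * u i := by
    rw [hvol l]
    exact sum_mul_le_rowNorm_mul (fun i j => zero_le_one.trans (hM i j)) (hu i).le hu₀_le l
  have hu'_le (k) : u' k ≤ rowNorm M' * (rowNorm M * u i) := by
    rw [hvol' k]
    exact sum_mul_le_rowNorm_mul (fun i j => zero_le_one.trans (hM' i j))
      ((hu i).le.trans (hu_le i)) hu_le k
  have hν_ge : ∑ k, ν' k ≤ ν i := by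
    rw [htr]
    exact Finset.sum_le_sum fun k _ => le_mul_of_one_le_right (hν' k).le (hM' k i)
  have hpos : 0 < rowNorm M' * (rowNorm M * u i) := (hu' ⟨0, ht'⟩).trans_le (hu'_le _)
  have hone : 1 ≤ rowNorm M * rowNorm M' * (u i * ν i) :=
    calc 1 = ∑ k, u' k * ν' k := hnorm.symm
      _ ≤ ∑ k, rowNorm M' * (rowNorm M * u i) * ν' k :=
        Finset.sum_le_sum fun k _ => mul_le_mul_of_nonneg_right (hu'_le k) (hν' k).le
      _ = rowNorm M' * (rowNorm M * u i) * ∑ k, ν' k := (Finset.mul_sum _ _ _).symm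
      _ ≤ rowNorm M' * (rowNorm M * u i) * ν i := mul_le_mul_of_nonneg_left hν_ge hpos.le
      _ = rowNorm M * rowNorm M' * (u i * ν i) := by ring
  have hnorms : 0 < rowNorm M * rowNorm M' :=
    pos_of_mul_pos_left (zero_lt_one.trans_le hone) (mul_pos (hu i) (hν i)).le
  exact (inv_le_iff_one_le_mul₀' hnorms).2 hone
end
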